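/- Let e ∈ A be a half-axis, u₁, u₂, u₃ ∈ U := A_{1/2}(e) and z ∈ Z := A_0(e). Then: (1) u₁(u₂u₃) + (u₁u₂)u₃ + (u₁u₃)u₂ = δ_{u₂u₃}u₁ + δ_{u₁u₃}u₂ + δ_{u₁u₂}u₃; (2) u₁²u₂ + 2u₁(u₁u₂) = δ_{u₁²}u₂ + 2δ_{u₁u₂}u₁; (3) (u₁²u₂)z = −2u₁((u₁u₂)z) + 2(u₁u₂)(u₁z) + δ_{u₁²}·u₂z; (4) 2u₁²(u₁z) = δ_{u₁²}·u₁z + δ_{u₁(u₁z)}·u₁. -/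

import Mathlib

/-- `A_λ(e)`-based definition of a half-axis in a commutative non-associative `F`-algebra `A`:
`e` is idempotent, `A_1(e) = F e`, `A = F e ⊕ A_{1/2}(e) ⊕ A_0(e)`, and the fusion rules
`Z Z ⊆ Z`, `U U ⊆ F e + Z`, `U Z ⊆ U` hold, where `U = A_{1/2}(e)` and `Z = A_0(e)`. -/
structure IsHalfAxis (F : Type*) [Field F] {A : Type*} [NonUnitalNonAssocCommRing A]
    [Module F A] [SMulCommClass F A A] [IsScalarTower F A A] (e : A) : Prop where
  idem : e * e = e
  eig_one : {y : A | e * y = y} = {y : A | ∃ c : F, y = c • e}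
  decomp : ∀ x : A, ∃ (c : F) (u z : A),
      e * u = (2⁻¹ : F) • u ∧ e * z = 0 ∧ x = c • e + u + z
  indep : ∀ (c : F) (u z : A), e * u = (2⁻¹ : F) • u → e * z = 0 →
      c • e + u + z = 0 → c = 0 ∧ u = 0 ∧ z = 0
  fusionZZ : ∀ z z' : A, e * z = 0 → e * z' = 0 → e * (z * z') = 0
  fusionUU : ∀ u u' : A, e * u = (2⁻¹ : F) • u → e * u' = (2⁻¹ : F) • u' →
      ∃ (c : F) (z : A), e * z = 0 ∧ u * u' = c • e + z
  fusionUZ : ∀ u z : A, e * u = (2⁻¹ : F) • u → e * z = 0 →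
      e * (u * z) = (2⁻¹ : F) • (u * z)

section Linearization

variable {F A : Type*} [Field F] [NonUnitalNonAssocCommRing A] [Module F A]
  [SMulCommClass F A A]

/-- A field with more than three elements contains an element outside `{0, 1, -1}`. -/
theorem exists_ne_zero_sq_ne_one (hF : 3 < Cardinal.mk F) : ∃ t : F, t ≠ 0 ∧ t ^ 2 ≠ 1 := by
  by_contra! h
  have hs : (Set.univ : Set F) ⊆ {0, 1, -1} := by
    intro t _
    by_cases ht : t = 0
    · simp [ht]
    · rcases (by simpa using h t ht : t = 1 ∨ t = -1) with h | h <;> simp [h]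
  have hle := Cardinal.mk_le_mk_of_subset hs
  rw [Cardinal.mk_univ] at hle
  refine (hF.trans_le hle).not_ge ((Cardinal.mk_insert_le).trans ?_)
  refine (add_le_add_left ((Cardinal.mk_insert_le).trans (add_le_add_left
    (Cardinal.mk_singleton _).le 1)) 1).trans ?_
  norm_num

/-- The odd part in `u` of the identity `x² x² = x⁴` at `x = s + t u`. -/
theorem odd_part_fourth_power (h2 : (2 : F) ≠ 0)
    (hid : ∀ x : A, (x * x) * (x * x) = ((x * x) * x) * x) (s u : A) (t : F) (ht : t ≠ 0) :
    (4 : F) • ((s * s) * (u * s)) - (2 : F) • (((u * s) * s) * s) - (u * (s * s)) * s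
        - u * ((s * s) * s)
      + (t ^ 2) • ((4 : F) • ((u * u) * (u * s)) - (2 : F) • (u * (u * (u * s)))
        - u * ((u * u) * s) - ((u * u) * u) * s) = 0 := by
  have hp := hid (s + t • u)
  have hn := hid (s + (-t) • u)
  refine (smul_eq_zero_iff_right (mul_ne_zero h2 ht)).mp ?_
  simp only [mul_add, mul_smul_comm, smul_add, smul_smul,
    mul_comm (G := A)] at hp hn ⊢
  linear_combination (norm := module) hp - hn

/-- The parts of `x² x² = x⁴` of degree one and three in `u` vanish separately. -/
theorem linear_and_cubic_part_fourth_power (h2 : (2 : F) ≠ 0) (hF : 3 < Cardinal.mk F)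
    (hid : ∀ x : A, (x * x) * (x * x) = ((x * x) * x) * x) (s u : A) :
    ((4 : F) • ((s * s) * (u * s)) - (2 : F) • (((u * s) * s) * s) - (u * (s * s)) * s
        - u * ((s * s) * s) = 0) ∧
      ((4 : F) • ((u * u) * (u * s)) - (2 : F) • (u * (u * (u * s)))
        - u * ((u * u) * s) - ((u * u) * u) * s = 0) := by
  obtain ⟨t, ht, ht'⟩ := exists_ne_zero_sq_ne_one hF
  have h1 := odd_part_fourth_power h2 hid s u 1 one_ne_zero
  have h3 := odd_part_fourth_power h2 hid s u t ht
  generalize (4 : F) • ((s * s) * (u * s)) - (2 : F) • (((u * s) * s) * s) - (u * (s * s)) * s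
        - u * ((s * s) * s) = a at *
  generalize (4 : F) • ((u * u) * (u * s)) - (2 : F) • (u * (u * (u * s)))
        - u * ((u * u) * s) - ((u * u) * u) * s = b at *
  have hb : b = 0 := by
    refine (smul_eq_zero_iff_right (sub_ne_zero.mpr ht')).mp ?_
    linear_combination (norm := module) h3 - h1
  subst hb
  simpa using h1

/-- In characteristic three, the part of `x³ x² = x x⁴` of degree one in `u` vanishes. -/
theorem linear_part_fifth_power (h2 : (2 : F) ≠ 0) (h3 : (3 : F) = 0) (hF : 3 < Cardinal.mk F)
    (hid : ∀ x : A, ((x * x) * x) * (x * x) = x * (((x * x) * x) * x)) (s u : A) :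
    (((2 : F) • (u * s)) * s + (s * s) * u) * (s * s) + ((s * s) * s) * ((2 : F) • (u * s))
      - s * ((((2 : F) • (u * s)) * s + (s * s) * u) * s + ((s * s) * s) * u)
      - u * (((s * s) * s) * s) = 0 := by
  have key : ∃ b c : A, ∀ t : F, t ≠ 0 →
      (((2 : F) • (u * s)) * s + (s * s) * u) * (s * s) + ((s * s) * s) * ((2 : F) • (u * s))
      - s * ((((2 : F) • (u * s)) * s + (s * s) * u) * s + ((s * s) * s) * u)
      - u * (((s * s) * s) * s) + (t ^ 2) • b + (t ^ 4) • c = 0 := by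
    refine ⟨((u * u) * u) * (s * s) + ((u * u) * s + ((2 : F) • (u * s)) * u) * ((2 : F) • (u * s))
      + (((2 : F) • (u * s)) * s + (s * s) * u) * (u * u)
      - s * (((u * u) * u) * s + ((u * u) * s + ((2 : F) • (u * s)) * u) * u)
      - u * (((u * u) * s + ((2 : F) • (u * s)) * u) * s
        + (((2 : F) • (u * s)) * s + (s * s) * u) * u),
      ((u * u) * u) * (u * u) - u * (((u * u) * u) * u), fun t ht => ?_⟩
    have hp := hid (s + t • u)
    have hn := hid (s + (-t) • u)
    refine (smul_eq_zero_iff_right (mul_ne_zero h2 ht)).mp ?_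
    simp only [mul_add, mul_smul_comm, smul_add, smul_smul, mul_comm (G := A)] at hp hn ⊢
    linear_combination (norm := module) hp - hn
  obtain ⟨t, ht0, ht2, ht4⟩ : ∃ t : F, t ≠ 0 ∧ t ^ 2 ≠ 1 ∧ t ^ 4 ≠ 1 := by
    obtain ⟨t, ht, ht'⟩ := exists_ne_zero_sq_ne_one hF
    by_cases h4 : t ^ 4 = 1
    · have hsq : t ^ 2 = -1 := by
        apply mul_left_cancel₀ (sub_ne_zero.mpr ht')
        linear_combination h4
      have hy : (1 + t) ^ 2 = -t := by linear_combination hsq + t * h3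
      have hy4 : (1 + t) ^ 4 = -1 := by linear_combination ((1 + t) ^ 2 - t) * hy + hsq
      refine ⟨1 + t, fun h => ?_, fun h => ?_, fun h => ?_⟩
      · exact ht' (by linear_combination (t - 1) * h)
      · exact ht' (by linear_combination (1 - t) * (h - hy))
      · exact h2 (by linear_combination hy4 - h)
    · exact ⟨t, ht, ht', h4⟩
  obtain ⟨b, c, hbc⟩ := key
  have e₁ := hbc 1 one_ne_zero
  have e₂ := hbc t ht0
  have e₃ := hbc (t ^ 2) (pow_ne_zero 2 ht0)
  generalize (((2 : F) • (u * s)) * s + (s * s) * u) * (s * s)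
    + ((s * s) * s) * ((2 : F) • (u * s))
    - s * ((((2 : F) • (u * s)) * s + (s * s) * u) * s + ((s * s) * s) * u)
    - u * (((s * s) * s) * s) = a at *
  have hb : b + (t ^ 2 + 1) • c = 0 := by
    refine (smul_eq_zero_iff_right (sub_ne_zero.mpr ht2)).mp ?_
    linear_combination (norm := module) e₂ - e₁
  have hb' : b + (t ^ 4 + 1) • c = 0 := by
    refine (smul_eq_zero_iff_right (sub_ne_zero.mpr ht4)).mp ?_
    linear_combination (norm := module) e₃ - e₁
  have hc : c = 0 := by
    refine (smul_eq_zero_iff_right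
      (mul_ne_zero (pow_ne_zero 2 ht0) (sub_ne_zero.mpr ht2))).mp ?_
    linear_combination (norm := module) hb' - hb
  subst hc
  have hb0 : b = 0 := by simpa using hb
  subst hb0
  simpa using e₁

/-- Multiplication of `A_{1/2}` by the square of an element of `A_0`; here `f` is twice the
half-axis. -/
theorem half_mul_sq_zero (h2 : (2 : F) ≠ 0) (hF : 3 < Cardinal.mk F)
    (hid1 : ∀ x : A, (x * x) * (x * x) = ((x * x) * x) * x)
    (hid2 : ∀ x : A, ((x * x) * x) * (x * x) = x * (((x * x) * x) * x))
    {f : A} (hff : f * f = (2 : F) • f)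
    (hZZ : ∀ z z' : A, f * z = 0 → f * z' = 0 → f * (z * z') = 0)
    (hUZ : ∀ u z : A, f * u = u → f * z = 0 → f * (u * z) = u * z)
    {u z : A} (hu : f * u = u) (hz : f * z = 0) :
    u * (z * z) = (2 : F) • ((u * z) * z) := by
  have hv := hUZ u z hu hz
  have hw := hUZ _ z hv hz
  have hw' := hUZ _ z hw hz
  have hq := hZZ z z hz hz
  have hq' := hZZ _ z hq hz
  have hy := hUZ u _ hu hq
  have hy' := hUZ _ z hy hz
  have huq' := hUZ _ _ hu hq'
  have G₁ := (linear_and_cubic_part_fourth_power h2 hF hid1 (f + z) u).1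
  have G₂ := (linear_and_cubic_part_fourth_power h2 hF hid1 z u).1
  simp only [mul_comm (G := A)] at hu hz hv hw hw' hq hq' hy hy' huq'
  have h3X : (3 : F) • (u * (z * z) - (2 : F) • ((u * z) * z)) = 0 := by
    simp only [mul_add, add_mul, mul_smul_comm, smul_add, smul_smul, mul_zero, mul_comm (G := A),
      hff, hu, hz, hv, hw, hq, hy] at G₁ G₂ ⊢
    linear_combination (norm := module) G₁ - G₂
  by_cases h3 : (3 : F) = 0
  · have H₁ := linear_part_fifth_power h2 h3 hF hid2 (f + z) u
    have H₂ := linear_part_fifth_power h2 h3 hF hid2 (f - z) u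
    have H₃ := linear_part_fifth_power h2 h3 hF hid2 z u
    have h10X : (10 : F) • (u * (z * z) - (2 : F) • ((u * z) * z)) = 0 := by
      simp only [mul_add, add_mul, mul_sub, mul_smul_comm, smul_add,
        smul_sub, smul_smul, mul_zero, mul_comm (G := A),
        hff, hu, hz, hv, hw, hw', hq, hq', hy, hy', huq'] at H₁ H₂ H₃ ⊢
      linear_combination (norm := module) H₁ + H₂ - (2 : F) • H₃
    refine sub_eq_zero.mp ?_
    linear_combination (norm := module) h10X - (3 : F) • h3X
  · exact sub_eq_zero.mp ((smul_eq_zero_iff_right h3).mp h3X)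

/-- The `A_0`-part of the square of an element of `A_{1/2}` acts on it as a scalar; here `f` is
twice the half-axis. -/
theorem half_mul_zero_part_sq (h2 : (2 : F) ≠ 0) (hF : 3 < Cardinal.mk F)
    (hid : ∀ x : A, (x * x) * (x * x) = ((x * x) * x) * x)
    {f : A} (hff : f * f = (2 : F) • f)
    (hUZ : ∀ u z : A, f * u = u → f * z = 0 → f * (u * z) = u * z)
    {u p : A} {D : F} (hu : f * u = u) (hp : f * p = 0) (huu : u * u = D • f + p) :
    u * p = D • u := by
  have hup := hUZ u p hu hp
  have G := (linear_and_cubic_part_fourth_power h2 hF hid f u).2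
  simp only [mul_add, mul_smul_comm, smul_add, smul_smul, mul_comm (G := A),
    mul_zero, hff, hu, hp, hup, huu] at G ⊢
  linear_combination (norm := module) G

/-- Polarization of an identity `u z_{u²} = δ u` on the half-space of `f`. -/
theorem half_mul_zero_part_polar (h2 : (2 : F) ≠ 0) {f : A}
    (hUU : ∀ u v : A, f * u = u → f * v = v → ∃ (D : F) (p : A), f * p = 0 ∧ u * v = D • f + p)
    (hsq : ∀ (u p : A) (D : F), f * u = u → f * p = 0 → u * u = D • f + p → u * p = D • u)
    {u v p q : A} {D E : F} (hu : f * u = u) (hv : f * v = v) (hp : f * p = 0) (hq : f * q = 0)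
    (huu : u * u = D • f + p) (huv : u * v = E • f + q) :
    (2 : F) • (u * q) + v * p = (2 * E) • u + D • v := by
  obtain ⟨D', p', hp', hvv⟩ := hUU v v hv hv
  have hvu : v * u = E • f + q := by rw [mul_comm, huv]
  have h₁ := hsq (u + v) (p + p' + (2 : F) • q) (D + D' + 2 * E) (by rw [mul_add, hu, hv])
    (by simp [mul_add, mul_smul_comm, hp, hp', hq])
    (by simp only [mul_add, add_mul, huu, huv, hvu, hvv]; module)
  have h₂ := hsq (u - v) (p + p' - (2 : F) • q) (D + D' - 2 * E) (by rw [mul_sub, hu, hv])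
    (by simp [mul_add, mul_sub, mul_smul_comm, hp, hp', hq])
    (by simp only [mul_sub, sub_mul, huu, huv, hvu, hvv]; module)
  have h₃ := hsq v p' D' hv hp' hvv
  refine sub_eq_zero.mp ((smul_eq_zero_iff_right h2).mp ?_)
  simp only [mul_add, mul_sub, add_mul, sub_mul, mul_smul_comm] at h₁ h₂
  linear_combination (norm := module) h₁ - h₂ - (2 : F) • h₃

end Linearization

theorem stmt10 {F : Type*} [Field F] {A : Type*} [NonUnitalNonAssocCommRing A]
    [Module F A] [SMulCommClass F A A] [IsScalarTower F A A]
    (h2 : (2 : F) ≠ 0) (hF : 3 < Cardinal.mk F)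
    (hid1 : ∀ x : A, (x * x) * (x * x) = ((x * x) * x) * x)
    (hid2 : ∀ x : A, ((x * x) * x) * (x * x) = x * (((x * x) * x) * x))
    (e : A) (he : IsHalfAxis F e)
    (u₁ u₂ u₃ z : A) (hu₁ : e * u₁ = (2⁻¹ : F) • u₁) (hu₂ : e * u₂ = (2⁻¹ : F) • u₂)
    (hu₃ : e * u₃ = (2⁻¹ : F) • u₃) (hz : e * z = 0)
    (d₂₃ d₁₃ d₁₂ d₁ dz : F) (z₂₃ z₁₃ z₁₂ z₁ w : A)
    (hz₂₃ : e * z₂₃ = 0) (hz₁₃ : e * z₁₃ = 0) (hz₁₂ : e * z₁₂ = 0)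
    (hz₁ : e * z₁ = 0) (hw : e * w = 0)
    (hdec23 : u₂ * u₃ = d₂₃ • e + z₂₃) (hdec13 : u₁ * u₃ = d₁₃ • e + z₁₃)
    (hdec12 : u₁ * u₂ = d₁₂ • e + z₁₂) (hdec1 : u₁ * u₁ = d₁ • e + z₁)
    (hdecz : u₁ * (u₁ * z) = dz • e + w) :
    (u₁ * (u₂ * u₃) + (u₁ * u₂) * u₃ + (u₁ * u₃) * u₂ =
      d₂₃ • u₁ + d₁₃ • u₂ + d₁₂ • u₃) ∧
    ((u₁ * u₁) * u₂ + (2 : F) • (u₁ * (u₁ * u₂)) = d₁ • u₂ + (2 * d₁₂) • u₁) ∧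
    (((u₁ * u₁) * u₂) * z =
      -((2 : F) • (u₁ * ((u₁ * u₂) * z))) + (2 : F) • ((u₁ * u₂) * (u₁ * z)) +
        d₁ • (u₂ * z)) ∧
    ((2 : F) • ((u₁ * u₁) * (u₁ * z)) = d₁ • (u₁ * z) + dz • u₁) := by
  obtain ⟨f, hf⟩ : ∃ f : A, f = (2 : F) • e := ⟨_, rfl⟩
  have hhalf : ∀ x : A, e * x = (2⁻¹ : F) • x ↔ f * x = x := fun x => by
    rw [hf, smul_mul_assoc, eq_inv_smul_iff₀ h2]
  have hzero : ∀ x : A, e * x = 0 ↔ f * x = 0 := fun x => by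
    rw [hf, smul_mul_assoc, smul_eq_zero_iff_right h2]
  have hscale : ∀ d : F, ∃ D : F, d = 2 * D ∧ d • e = D • f := fun d =>
    ⟨2⁻¹ * d, (mul_inv_cancel_left₀ h2 d).symm, by
      rw [hf, smul_smul, mul_comm, mul_inv_cancel_left₀ h2]⟩
  have hff : f * f = (2 : F) • f := by
    rw [hf, smul_mul_assoc, mul_smul_comm, he.idem]
  have hZZ := he.fusionZZ
  have hUZ := he.fusionUZ
  have hUU : ∀ u v : A, f * u = u → f * v = v →
      ∃ (D : F) (p : A), f * p = 0 ∧ u * v = D • f + p := fun u v hu hv => by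
    obtain ⟨c, p, hp, huv⟩ := he.fusionUU u v ((hhalf u).mpr hu) ((hhalf v).mpr hv)
    obtain ⟨D, -, hD⟩ := hscale c
    exact ⟨D, p, (hzero p).mp hp, by rw [huv, hD]⟩
  simp only [hhalf, hzero] at hu₁ hu₂ hu₃ hz hz₂₃ hz₁₃ hz₁₂ hz₁ hw hZZ hUZ
  obtain ⟨D₂₃, rfl, hD₂₃⟩ := hscale d₂₃
  obtain ⟨D₁₃, rfl, hD₁₃⟩ := hscale d₁₃
  obtain ⟨D₁₂, rfl, hD₁₂⟩ := hscale d₁₂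
  obtain ⟨D₁, rfl, hD₁⟩ := hscale d₁
  obtain ⟨Dz, rfl, hDz⟩ := hscale dz
  rw [hD₂₃] at hdec23
  rw [hD₁₃] at hdec13
  rw [hD₁₂] at hdec12
  rw [hD₁] at hdec1
  rw [hDz] at hdecz
  have hpolar : ∀ {u v p q : A} {D E : F}, f * u = u → f * v = v → f * p = 0 → f * q = 0 →
      u * u = D • f + p → u * v = E • f + q →
      (2 : F) • (u * q) + v * p = (2 * E) • u + D • v :=
    half_mul_zero_part_polar h2 hUU fun u p D => half_mul_zero_part_sq h2 hF hid1 hff hUZ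
  have hmul : ∀ {u z z' : A}, f * u = u → f * z = 0 → f * z' = 0 →
      u * (z * z') = (u * z) * z' + (u * z') * z := fun {u z z'} hu hz hz' => by
    have hs := half_mul_sq_zero h2 hF hid1 hid2 hff hZZ hUZ hu
      (show f * (z + z') = 0 by rw [mul_add, hz, hz', add_zero])
    have h₁ := half_mul_sq_zero h2 hF hid1 hid2 hff hZZ hUZ hu hz
    have h₂ := half_mul_sq_zero h2 hF hid1 hid2 hff hZZ hUZ hu hz'
    refine sub_eq_zero.mp ((smul_eq_zero_iff_right h2).mp ?_)
    simp only [mul_add, add_mul, mul_comm z' z] at hs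
    linear_combination (norm := module) hs - h₁ - h₂
  have hp₁₂ := hpolar hu₁ hu₂ hz₁ hz₁₂ hdec1 hdec12
  have huf₁ : u₁ * f = u₁ := by rw [mul_comm, hu₁]
  refine ⟨?_, ?_, ?_, ?_⟩
  · obtain ⟨D₂, p₂, hp₂, hdec2⟩ := hUU u₂ u₂ hu₂ hu₂
    have hp₁₃ := hpolar hu₁ hu₃ hz₁ hz₁₃ hdec1 hdec13
    have hp₂₃ := hpolar hu₂ hu₃ hp₂ hz₂₃ hdec2 hdec23
    have hsum := hpolar (u := u₁ + u₂) (p := z₁ + p₂ + (2 : F) • z₁₂) (q := z₁₃ + z₂₃)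
      (D := D₁ + D₂ + 2 * D₁₂) (E := D₁₃ + D₂₃) (by rw [mul_add, hu₁, hu₂]) hu₃
      (by simp [mul_add, mul_smul_comm, hz₁, hp₂, hz₁₂]) (by simp [mul_add, hz₁₃, hz₂₃])
      (by simp only [mul_add, add_mul, hdec1, hdec2, mul_comm u₂ u₁, hdec12]; module)
      (by simp only [add_mul, hdec13, hdec23]; module)
    refine sub_eq_zero.mp ((smul_eq_zero_iff_right h2).mp ?_)
    simp only [mul_add, add_mul, mul_smul_comm] at hsum
    simp only [hdec12, hdec13, hdec23, mul_add, add_mul, mul_smul_comm, smul_mul_assoc, huf₁,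
      hu₂, hu₃, mul_comm z₁₂ u₃, mul_comm z₁₃ u₂]
    linear_combination (norm := module) hsum - hp₁₃ - hp₂₃
  · simp only [hdec1, hdec12, mul_add, add_mul, mul_smul_comm, smul_mul_assoc, huf₁, hu₂,
      mul_comm z₁ u₂]
    linear_combination (norm := module) hp₁₂
  · have hL := hmul hu₁ hz₁₂ hz
    have hpz := congrArg (· * z) hp₁₂
    simp only [add_mul, smul_mul_assoc] at hpz
    simp only [hdec1, hdec12, add_mul, smul_mul_assoc, hu₂, hz,
      hUZ u₁ z hu₁ hz, smul_zero, zero_add, mul_comm z₁ u₂, mul_comm z₁₂ (u₁ * z)]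
    linear_combination (norm := module) hpz + (2 : F) • hL
  · have hv := hUZ u₁ z hu₁ hz
    have hL := hmul hu₁ hz₁ hz
    have hp := hpolar hu₁ hv hz₁ hw hdec1 hdecz
    have hs := half_mul_zero_part_sq h2 hF hid1 hff hUZ hu₁ hz₁ hdec1
    have G := (linear_and_cubic_part_fourth_power h2 hF hid1 z u₁).2
    refine sub_eq_zero.mp ((smul_eq_zero_iff_right h2).mp ?_)
    simp only [hdec1, hdecz, mul_add, add_mul, mul_smul_comm, smul_mul_assoc, huf₁, hu₁, hz,
      hv, hs, mul_comm z₁ u₁, mul_comm z₁ (u₁ * z), smul_zero, zero_add, smul_add, smul_smul]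
      at G hL ⊢
    linear_combination (norm := module) G + hp + hL
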